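/- arXiv:2504.01701 — 14 statements merged into one kernel-verified Lean document; each statement's English description precedes it below -/
import Mathlib

section
/- Let g be a linear automorphism of V that permutes Φ, let A ∈ V, and set φ := φ_A. Then the following are equivalent: (1) g(t_φ) ⊆ t_φ; (2) {α ∘ g : α ∈ φ} = φ; (3) {α ∘ g : α ∈ φ} = φ and {α ∘ g : α ∈ Φ ∖ φ} = Φ ∖ φ; (4) g(B(A)) ⊆ B(A); (5) g(A') ∈ B(A) for every A' ∈ B(A). -/
/-- Let `V` be a finite-dimensional complex vector space, `Φ` a finite set of
nonzero linear functionals, `g` a linear automorphism of `V` permuting `Φ`, `A ∈ V`,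
`φ := φ_A` the Levi annihilator of `A`. Then the five conditions are equivalent. -/
theorem stmt0 {V : Type*} [AddCommGroup V] [Module ℂ V] [FiniteDimensional ℂ V]
    (Φ : Set (V →ₗ[ℂ] ℂ)) (hΦfin : Φ.Finite) (hΦne : ∀ α ∈ Φ, α ≠ 0)
    (g : V ≃ₗ[ℂ] V)
    (hperm : (fun α : V →ₗ[ℂ] ℂ => α.comp (g : V →ₗ[ℂ] V)) '' Φ = Φ)
    (A : V) :
    let φ : Set (V →ₗ[ℂ] ℂ) := {α ∈ Φ | α A = 0}
    let tφ : Set V := {x | ∀ α ∈ φ, α x = 0}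
    let B : Set V := {x ∈ tφ | ∀ α ∈ Φ \ φ, α x ≠ 0}
    List.TFAE
      [∀ x ∈ tφ, g x ∈ tφ,
       (fun α : V →ₗ[ℂ] ℂ => α.comp (g : V →ₗ[ℂ] V)) '' φ = φ,
       (fun α : V →ₗ[ℂ] ℂ => α.comp (g : V →ₗ[ℂ] V)) '' φ = φ ∧
         (fun α : V →ₗ[ℂ] ℂ => α.comp (g : V →ₗ[ℂ] V)) '' (Φ \ φ) = Φ \ φ,
       ∀ x ∈ B, g x ∈ B,
       ∀ A' ∈ B, g A' ∈ B] := by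
  intro φ tφ B
  set T : (V →ₗ[ℂ] ℂ) → (V →ₗ[ℂ] ℂ) := fun α => α.comp (g : V →ₗ[ℂ] V) with hT
  have hinj : Function.Injective T := by
    intro α β h
    ext x
    simpa [hT] using LinearMap.congr_fun h (g.symm x)
  have hmem : ∀ α ∈ Φ, T α ∈ Φ := fun α hα => hperm ▸ Set.mem_image_of_mem T hα
  have hA : A ∈ tφ := fun α hα => hα.2
  have hAB : A ∈ B := ⟨hA, fun α hα h => hα.2 ⟨hα.1, h⟩⟩
  have hφfin : φ.Finite := hΦfin.subset fun α hα => hα.1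
  have image_eq : g A ∈ tφ → T '' φ = φ := by
    intro h
    refine Set.eq_of_subset_of_ncard_le ?_ (Set.ncard_image_of_injective φ hinj).ge hφfin
    rintro _ ⟨α, hα, rfl⟩
    exact ⟨hmem α hα.1, h α hα⟩
  tfae_have 1 → 2 := fun h => image_eq (h A hA)
  tfae_have 2 → 1 := fun h x hx α hα => hx (T α) (h ▸ Set.mem_image_of_mem T hα)
  tfae_have 2 → 3 := fun h => ⟨h, by rw [Set.image_sdiff hinj, hperm, h]⟩
  tfae_have 3 → 5 := fun h x hx =>
    ⟨fun α hα => hx.1 (T α) (h.1.subset (Set.mem_image_of_mem T hα)),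
      fun α hα => hx.2 (T α) (h.2.subset (Set.mem_image_of_mem T hα))⟩
  tfae_have 5 → 4 := id
  tfae_have 4 → 2 := fun h => image_eq (h A hAB).1
  tfae_finish
end

section
/- Let A ∈ V and φ := φ_A. For every g ∈ W the following are equivalent: (1) g(x) = x for every x ∈ t_φ; (2) g(A') = A' for every A' ∈ B(A); (3) g(A) = A. -/
/-- A linear automorphism fixing the kernel of `α` pointwise and a vector outside that kernel is
the identity. -/
lemma LinearEquiv.eq_one_of_fixes_ker_of_apply_ne_zero {K V : Type*} [Field K] [AddCommGroup V]
    [Module K V] (u : V ≃ₗ[K] V) (α : V →ₗ[K] K) (A : V) (hker : ∀ x, α x = 0 → u x = x)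
    (hA : u A = A) (hα : α A ≠ 0) : u = 1 := by
  ext x
  have h := hker (x - (α x / α A) • A) (by simp [hα])
  simpa [hA] using h


/-- With `W` a finite subgroup of `GL(V)` whose elements permute `Φ`,
satisfying (i) every nonidentity element of `W` fixing a hyperplane pointwise fixes the
kernel of some root pointwise, and (ii) point stabilizers in `W` are generated by their
elements fixing a hyperplane pointwise: for `A ∈ V`, `φ := φ_A` and `g ∈ W` the following
are equivalent: `g` fixes `t_φ` pointwise; `g` fixes `B(A)` pointwise; `g A = A`. -/
theorem stmt1 {V : Type*} [AddCommGroup V] [Module ℂ V] [FiniteDimensional ℂ V]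
    (Φ : Set (V →ₗ[ℂ] ℂ)) (hΦfin : Φ.Finite) (hΦne : ∀ α ∈ Φ, α ≠ 0)
    (W : Subgroup (V ≃ₗ[ℂ] V)) (hWfin : (W : Set (V ≃ₗ[ℂ] V)).Finite)
    (hWperm : ∀ w ∈ W, (fun α : V →ₗ[ℂ] ℂ => α.comp ((w : V ≃ₗ[ℂ] V) : V →ₗ[ℂ] V)) '' Φ = Φ)
    (hrefl : ∀ w ∈ W, w ≠ 1 →
      (∃ f : V →ₗ[ℂ] ℂ, f ≠ 0 ∧ ∀ x : V, f x = 0 → w x = x) →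
      ∃ α ∈ Φ, ∀ x : V, α x = 0 → w x = x)
    (hstab : ∀ B : V, ∀ w ∈ W, w B = B →
      w ∈ Subgroup.closure {u : V ≃ₗ[ℂ] V | u ∈ W ∧ u B = B ∧
        ∃ f : V →ₗ[ℂ] ℂ, f ≠ 0 ∧ ∀ x : V, f x = 0 → u x = x})
    (A : V) (g : V ≃ₗ[ℂ] V) (hg : g ∈ W) :
    let φ : Set (V →ₗ[ℂ] ℂ) := {α ∈ Φ | α A = 0}
    let tφ : Set V := {x | ∀ α ∈ φ, α x = 0}
    let B : Set V := {x ∈ tφ | ∀ α ∈ Φ \ φ, α x ≠ 0}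
    List.TFAE
      [∀ x ∈ tφ, g x = x,
       ∀ A' ∈ B, g A' = A',
       g A = A] := by
  intro φ tφ B
  tfae_have 1 → 2 := fun h A' hA' => h A' hA'.1
  tfae_have 2 → 3 := fun h =>
    h A ⟨fun _ hα => hα.2, fun _ hα h0 => hα.2 ⟨hα.1, h0⟩⟩
  tfae_have 3 → 1 := by
    intro hgA x hx
    have hcl := hstab A g hg hgA
    clear hg hgA tfae_1_to_2 tfae_2_to_3
    induction hcl using Subgroup.closure_induction with
    | mem u hu =>
      obtain ⟨huW, huA, hfix⟩ := hu
      by_cases hu1 : u = 1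
      · simp [hu1]
      obtain ⟨α, hα, hker⟩ := hrefl u huW hu1 hfix
      have hαA : α A = 0 := by
        by_contra h
        exact hu1 (u.eq_one_of_fixes_ker_of_apply_ne_zero α A hker huA h)
      exact hker x (hx α ⟨hα, hαA⟩)
    | one => rfl
    | mul u v _ _ hu hv => rw [LinearEquiv.mul_apply, hv, hu]
    | inv u _ hu => exact (LinearEquiv.symm_apply_eq u).2 hu.symm
  tfae_finish
end

section
/- Let A ∈ V, φ := φ_A, and let g, g' ∈ W and ζ ∈ ℂ satisfy g(A) = ζ·A and g'(A) = ζ·A. Then g and g' have the same restriction to t_φ, i.e. g(x) = g'(x) for every x ∈ t_φ. -/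
/-- A linear map that fixes a point off the hyperplane `ker α`, and fixes `ker α` pointwise,
fixes every vector. -/
theorem LinearEquiv.apply_eq_self_of_fixes_ker_of_fixes {K V : Type*} [Field K] [AddCommGroup V]
    [Module K V] {α : V →ₗ[K] K} {u : V ≃ₗ[K] V} (hu : ∀ x, α x = 0 → u x = x) {A : V}
    (hA : α A ≠ 0) (huA : u A = A) (x : V) : u x = x := by
  have h := hu (x - (α x / α A) • A) (by simp [hA])
  simpa [huA] using h


/-- In the same setting as Statement 1: if `g, g' ∈ W` and `ζ ∈ ℂ` satisfy
`g A = ζ • A` and `g' A = ζ • A`, then `g` and `g'` agree on `t_φ` where `φ = φ_A`. -/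
theorem stmt2 {V : Type*} [AddCommGroup V] [Module ℂ V] [FiniteDimensional ℂ V]
    (Φ : Set (V →ₗ[ℂ] ℂ)) (hΦfin : Φ.Finite) (hΦne : ∀ α ∈ Φ, α ≠ 0)
    (W : Subgroup (V ≃ₗ[ℂ] V)) (hWfin : (W : Set (V ≃ₗ[ℂ] V)).Finite)
    (hWperm : ∀ w ∈ W, (fun α : V →ₗ[ℂ] ℂ => α.comp ((w : V ≃ₗ[ℂ] V) : V →ₗ[ℂ] V)) '' Φ = Φ)
    (hrefl : ∀ w ∈ W, w ≠ 1 →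
      (∃ f : V →ₗ[ℂ] ℂ, f ≠ 0 ∧ ∀ x : V, f x = 0 → w x = x) →
      ∃ α ∈ Φ, ∀ x : V, α x = 0 → w x = x)
    (hstab : ∀ B : V, ∀ w ∈ W, w B = B →
      w ∈ Subgroup.closure {u : V ≃ₗ[ℂ] V | u ∈ W ∧ u B = B ∧
        ∃ f : V →ₗ[ℂ] ℂ, f ≠ 0 ∧ ∀ x : V, f x = 0 → u x = x})
    (A : V) (g g' : V ≃ₗ[ℂ] V) (hg : g ∈ W) (hg' : g' ∈ W)
    (ζ : ℂ) (hgA : g A = ζ • A) (hg'A : g' A = ζ • A) :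
    ∀ x : V, (∀ α ∈ Φ, α A = 0 → α x = 0) → g x = g' x := by
  intro x hx
  have hfix : g⁻¹ * g' ∈ MulAction.stabilizer (V ≃ₗ[ℂ] V) x := by
    have hA : (g⁻¹ * g') A = A := by
      rw [LinearEquiv.mul_apply, hg'A, ← hgA]
      exact g.symm_apply_apply A
    refine (Subgroup.closure_le _).2 ?_ (hstab A _ (W.mul_mem (W.inv_mem hg) hg') hA)
    rintro u ⟨huW, huA, huf⟩
    change u x = x
    by_cases hu : u = 1
    · simp [hu]
    obtain ⟨α, hα, hker⟩ := hrefl u huW hu huf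
    by_cases hαA : α A = 0
    · exact hker x (hx α hα hαA)
    · exact LinearEquiv.apply_eq_self_of_fixes_ker_of_fixes hker hαA huA x
  have h : g.symm (g' x) = x := hfix
  exact ((LinearEquiv.symm_apply_eq g).1 h).symm
end

section
/- Let A ∈ V have trivial stabilizer in W, and let g ∈ W and ζ ∈ ℂ satisfy g(A) = ζ·A. Then for every g' ∈ W the following are equivalent: (1) g'·g = g·g'; (2) g'(V(g,ζ)) ⊆ V(g,ζ); (3) g'(A) ∈ V(g,ζ). -/
/-- Let `W` be a finite subgroup of `GL(V)`, `A ∈ V` with trivial stabilizer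
in `W`, and `g ∈ W`, `ζ ∈ ℂ` with `g A = ζ • A`. Then for every `g' ∈ W` the following are
equivalent: `g'` commutes with `g`; `g'` maps the eigenspace `V(g,ζ)` into itself;
`g' A ∈ V(g,ζ)`. -/
theorem stmt3 {V : Type*} [AddCommGroup V] [Module ℂ V] [FiniteDimensional ℂ V]
    (W : Subgroup (V ≃ₗ[ℂ] V)) (hWfin : (W : Set (V ≃ₗ[ℂ] V)).Finite)
    (A : V) (hA : ∀ w ∈ W, w A = A → w = 1)
    (g : V ≃ₗ[ℂ] V) (hg : g ∈ W) (ζ : ℂ) (hgA : g A = ζ • A)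
    (g' : V ≃ₗ[ℂ] V) (hg' : g' ∈ W) :
    List.TFAE
      [g' * g = g * g',
       ∀ x : V, g x = ζ • x → g (g' x) = ζ • g' x,
       g (g' A) = ζ • g' A] := by
  tfae_have 1 → 2 := by
    intro h x hx
    have hcomm : g' (g x) = g (g' x) := LinearEquiv.congr_fun h x
    rw [← hcomm, hx, map_smul]
  tfae_have 2 → 3 := fun h => h A hgA
  tfae_have 3 → 1 := by
    intro h
    have hA' : (g * g') A = (g' * g) A := by
      rw [LinearEquiv.mul_apply, LinearEquiv.mul_apply, h, hgA, map_smul]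
    have hfix : ((g' * g)⁻¹ * (g * g')) A = A := by
      rw [LinearEquiv.mul_apply, hA', ← LinearEquiv.mul_apply, inv_mul_cancel]
      rfl
    exact inv_mul_eq_one.mp <|
      hA _ (W.mul_mem (W.inv_mem (W.mul_mem hg' hg)) (W.mul_mem hg hg')) hfix
  tfae_finish
end

section
/- Let U ⊆ V be a linear subspace, A ∈ U a vector in general position in U, and g, g' ∈ W with g(U) ⊆ U and g'(U) ⊆ U. Suppose g(A) = ζ·A for some ζ ∈ ℂ and set U(g,ζ) := {x ∈ U : g(x) = ζ·x}. Then the following are equivalent: (1) the restrictions of g and g' to U commute, i.e. g(g'(x)) = g'(g(x)) for all x ∈ U; (2) g'(U(g,ζ)) ⊆ U(g,ζ); (3) g'(A) ∈ U(g,ζ). -/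
/-- Let `W` be a finite subgroup of `GL(V)`, `U ⊆ V` a linear subspace,
`A ∈ U` in general position in `U`, and `g, g' ∈ W` preserving `U`, with `g A = ζ • A`.
Then the following are equivalent: the restrictions of `g` and `g'` to `U` commute;
`g'` maps `U(g,ζ) = {x ∈ U : g x = ζ • x}` into itself; `g' A ∈ U(g,ζ)`. -/
theorem stmt4 {V : Type*} [AddCommGroup V] [Module ℂ V] [FiniteDimensional ℂ V]
    (W : Subgroup (V ≃ₗ[ℂ] V)) (hWfin : (W : Set (V ≃ₗ[ℂ] V)).Finite)
    (U : Submodule ℂ V) (A : V) (hAU : A ∈ U)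
    (hgen : ∀ w ∈ W, w A = A → ∀ x ∈ U, w x = x)
    (g g' : V ≃ₗ[ℂ] V) (hg : g ∈ W) (hg' : g' ∈ W)
    (hgU : ∀ x ∈ U, g x ∈ U) (hg'U : ∀ x ∈ U, g' x ∈ U)
    (ζ : ℂ) (hgA : g A = ζ • A) :
    List.TFAE
      [∀ x ∈ U, g (g' x) = g' (g x),
       ∀ x : V, x ∈ U ∧ g x = ζ • x → g' x ∈ U ∧ g (g' x) = ζ • g' x,
       g' A ∈ U ∧ g (g' A) = ζ • g' A] := by
  tfae_have 1 → 2 := by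
    rintro h x ⟨hx, hgx⟩
    exact ⟨hg'U x hx, by rw [h x hx, hgx, map_smul]⟩
  tfae_have 2 → 3 := fun h => h A ⟨hAU, hgA⟩
  tfae_have 3 → 1 := by
    rintro ⟨-, h⟩ x hx
    have hfix : ((g' * g)⁻¹ * (g * g')) A = A :=
      (LinearEquiv.symm_apply_eq (g' * g)).2 <| show g (g' A) = g' (g A) by
        rw [h, hgA, map_smul]
    exact (LinearEquiv.symm_apply_eq (g' * g)).1 <|
      hgen _ (W.mul_mem (W.inv_mem (W.mul_mem hg' hg)) (W.mul_mem hg hg')) hfix x hx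
  tfae_finish
end

section
/- Let m ≥ 1 and r ≥ 2 be integers, ζ ∈ ℂ a primitive r-th root of unity, g a permutation of {1,…,m}, and v : {1,…,m} → ℂ injective with v(g(i)) = ζ·v(i) for all i. Then every orbit of the cyclic group generated by g on {1,…,m} has exactly r elements and v is nonvanishing on it, except for at most one orbit, which is then a singleton {i₀} with g(i₀) = i₀ and v(i₀) = 0. In particular, either r divides m (and g has no fixed point) or r divides m−1 (and g has exactly one fixed point). -/
section RegularEigenvector

variable {α K : Type*} [Field K] {r : ℕ} {ζ : K} {g : Equiv.Perm α} {v : α → K}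

lemma eigenvector_zpow_apply (hζ : ζ ≠ 0) (heig : ∀ i, v (g i) = ζ * v i) (n : ℤ) (i : α) :
    v ((g ^ n) i) = ζ ^ n * v i := by
  induction n generalizing i with
  | zero => simp
  | succ k ih => rw [zpow_add_one, Equiv.Perm.mul_apply, ih, heig, zpow_add_one₀ hζ, mul_assoc]
  | pred k ih =>
    have h := heig (g⁻¹ i)
    rw [← Equiv.Perm.mul_apply, mul_inv_cancel, Equiv.Perm.one_apply] at h
    rw [zpow_sub_one, Equiv.Perm.mul_apply, ih, h, zpow_sub_one₀ hζ]
    field_simp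

lemma regular_eigenvector_fixed_iff (hζ : ζ ≠ 1) (hv : Function.Injective v)
    (heig : ∀ i, v (g i) = ζ * v i) (i : α) : g i = i ↔ v i = 0 := by
  rw [← hv.eq_iff, heig]
  constructor
  · exact fun h => by_contra fun hi => hζ (mul_right_cancel₀ hi (h.trans (one_mul _).symm))
  · intro h
    simp [h]

lemma regular_eigenvector_mem_orbit_iff [NeZero r] (hζ : IsPrimitiveRoot ζ r)
    (hv : Function.Injective v) (heig : ∀ i, v (g i) = ζ * v i) {i : α} (hi : v i ≠ 0) (j : α) :
    (∃ n : ℤ, (g ^ n) i = j) ↔ v j ^ r = v i ^ r := by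
  have h0 : ζ ≠ 0 := hζ.ne_zero (NeZero.ne r)
  constructor
  · rintro ⟨n, rfl⟩
    rw [eigenvector_zpow_apply h0 heig, mul_pow, ← zpow_natCast, ← zpow_mul, mul_comm n,
      zpow_mul, zpow_natCast, hζ.pow_eq_one, one_zpow, one_mul]
  · intro h
    obtain ⟨k, -, hk⟩ := hζ.eq_pow_of_pow_eq_one (ξ := v j / v i)
      (by rw [div_pow, h, div_self (pow_ne_zero _ hi)])
    refine ⟨k, hv ?_⟩
    rw [eigenvector_zpow_apply h0 heig, zpow_natCast, hk, div_mul_cancel₀ _ hi]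

lemma regular_eigenvector_ncard_orbit [NeZero r] (hζ : IsPrimitiveRoot ζ r)
    (hv : Function.Injective v) (heig : ∀ i, v (g i) = ζ * v i) {i : α} (hi : v i ≠ 0) :
    {j : α | ∃ n : ℤ, (g ^ n) i = j}.ncard = r := by
  have h0 : ζ ≠ 0 := hζ.ne_zero (NeZero.ne r)
  have hpow (k : ℕ) : v ((g ^ k) i) = ζ ^ k * v i := by
    simpa using eigenvector_zpow_apply h0 heig k i
  have horbit : {j : α | ∃ n : ℤ, (g ^ n) i = j} =
      (fun k : ℕ => (g ^ k) i) '' (Finset.range r : Set ℕ) := by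
    ext j
    constructor
    · intro hj
      have h := (regular_eigenvector_mem_orbit_iff hζ hv heig hi j).1 hj
      obtain ⟨k, hkr, hk⟩ := hζ.eq_pow_of_pow_eq_one (ξ := v j / v i)
        (by rw [div_pow, h, div_self (pow_ne_zero _ hi)])
      refine ⟨k, by simpa using hkr, hv ?_⟩
      simp only [hpow, hk, div_mul_cancel₀ _ hi]
    · rintro ⟨k, -, rfl⟩
      exact ⟨k, by simp⟩
  rw [horbit, Set.InjOn.ncard_image, Set.ncard_coe_finset, Finset.card_range]
  intro a ha b hb hab
  have h := congrArg v hab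
  simp only [hpow] at h
  exact hζ.pow_inj (by simpa using ha) (by simpa using hb) (mul_right_cancel₀ hi h)

open scoped Classical in
lemma regular_eigenvector_dvd_card [Fintype α] [NeZero r] (hζ : IsPrimitiveRoot ζ r)
    (hv : Function.Injective v) (heig : ∀ i, v (g i) = ζ * v i) :
    r ∣ (Finset.univ.filter fun i => v i ≠ 0).card := by
  rw [Finset.card_eq_sum_card_image (fun i => v i ^ r)]
  refine Finset.dvd_sum fun b hb => ?_
  obtain ⟨i, hi, rfl⟩ := Finset.mem_image.1 hb
  have hi : v i ≠ 0 := by simpa using hi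
  refine dvd_of_eq ((regular_eigenvector_ncard_orbit hζ hv heig hi).symm.trans ?_)
  rw [← Set.ncard_coe_finset]
  congr 1
  ext j
  simp only [Set.mem_ofPred_eq, regular_eigenvector_mem_orbit_iff hζ hv heig hi, Finset.coe_filter,
    Finset.mem_filter, Finset.mem_univ, true_and, iff_and_self]
  intro h hj
  rw [hj, zero_pow (NeZero.ne r)] at h
  exact pow_ne_zero r hi h.symm

end RegularEigenvector

/-- Let `m ≥ 1`, `r ≥ 2`, `ζ` a primitive `r`-th root of unity, `g` a
permutation of `{1,…,m}` and `v` an injective eigenvector of `g` with eigenvalue `ζ`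
(i.e. `v (g i) = ζ * v i`). Then every orbit of `⟨g⟩` has exactly `r` elements with `v`
nonvanishing on it, except for at most one orbit, which is then a fixed point where `v`
vanishes; in particular either `r ∣ m` (and `g` has no fixed point) or `r ∣ m − 1`
(and `g` has exactly one fixed point). -/
theorem stmt8 (m r : ℕ) (hm : 1 ≤ m) (hr : 2 ≤ r)
    (ζ : ℂ) (hζ : IsPrimitiveRoot ζ r)
    (g : Equiv.Perm (Fin m)) (v : Fin m → ℂ) (hv : Function.Injective v)
    (heig : ∀ i, v (g i) = ζ * v i) :
    (∀ i : Fin m,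
      ({j : Fin m | ∃ n : ℤ, (g ^ n) i = j}.ncard = r ∧
        ∀ j : Fin m, (∃ n : ℤ, (g ^ n) i = j) → v j ≠ 0) ∨
      (g i = i ∧ v i = 0)) ∧
    (∀ i j : Fin m, g i = i → v i = 0 → g j = j → v j = 0 → i = j) ∧
    (((∀ i, g i ≠ i) ∧ r ∣ m) ∨ ((∃! i, g i = i) ∧ r ∣ (m - 1))) := by
  have : NeZero r := ⟨by omega⟩
  have h0 : ζ ≠ 0 := hζ.ne_zero (NeZero.ne r)
  have hfix := regular_eigenvector_fixed_iff (hζ.ne_one (by omega)) hv heig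
  have hdvd := regular_eigenvector_dvd_card hζ hv heig
  refine ⟨fun i => ?_, fun i j _ hi _ hj => hv (hi.trans hj.symm), ?_⟩
  · by_cases hi : v i = 0
    · exact Or.inr ⟨(hfix i).2 hi, hi⟩
    · refine Or.inl ⟨regular_eigenvector_ncard_orbit hζ hv heig hi, ?_⟩
      rintro j ⟨n, rfl⟩
      rw [eigenvector_zpow_apply h0 heig]
      exact mul_ne_zero (zpow_ne_zero n h0) hi
  · by_cases h : ∃ i, v i = 0
    · obtain ⟨i, hi⟩ := h
      refine Or.inr ⟨⟨i, (hfix i).2 hi, fun j hj => hv (((hfix j).1 hj).trans hi.symm)⟩, ?_⟩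
      have hne : (Finset.univ.filter fun j => v j ≠ 0) = Finset.univ.erase i := by
        ext j
        simp [← hi, hv.eq_iff]
      simpa [hne] using hdvd
    · push Not at h
      exact Or.inl ⟨fun i hi => h i ((hfix i).1 hi), by simpa [h] using hdvd⟩
end

section
/- Let m ≥ 1 and r ≥ 2 be integers, ζ ∈ ℂ a primitive r-th root of unity, and g a permutation of {1,…,m} such that there exists an injective v : {1,…,m} → ℂ with v(g(i)) = ζ·v(i) for all i. Set k := m/r if r divides m, and k := (m−1)/r otherwise. Then the space {v' : {1,…,m} → ℂ : v' injective and v'(g(i)) = ζ·v'(i) for all i}, with the subspace topology from ℂ^m, is homeomorphic to M^#(r,k). -/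
/-- The hyperplane complement `M(ρ,k) := {λ ∈ ℂ^k : λ_i^ρ ≠ λ_j^ρ for i ≠ j}`. -/
def Mreg (ρ k : ℕ) : Set (Fin k → ℂ) :=
  {v | ∀ i j : Fin k, i ≠ j → v i ^ ρ ≠ v j ^ ρ}

/-- The hyperplane complement `M^#(ρ,k) := {λ ∈ M(ρ,k) : λ_i ≠ 0 for all i}`. -/
def MregSharp (ρ k : ℕ) : Set (Fin k → ℂ) :=
  {v | (∀ i j : Fin k, i ≠ j → v i ^ ρ ≠ v j ^ ρ) ∧ ∀ i, v i ≠ 0}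

/-- Representatives of the fibres of a function restricted to a finite set. -/
theorem exists_fin_fibre_representatives {α β : Type*} (s : Finset α) (f : α → β) :
    ∃ (k : ℕ) (t : Fin k → α), (∀ a, t a ∈ s) ∧ Function.Injective (f ∘ t) ∧
      ∀ i ∈ s, ∃ a, f i = f (t a) := by
  classical
  have h : ∀ a : Fin (s.image f).card, ∃ i ∈ s, f i = ((s.image f).equivFin.symm a : β) :=
    fun a => Finset.mem_image.mp ((s.image f).equivFin.symm a).2
  choose t hts ht using h
  refine ⟨_, t, hts, fun a b hab => ?_, fun i hi => ?_⟩
  · simp only [Function.comp_apply, ht] at hab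
    exact (s.image f).equivFin.symm.injective (Subtype.ext hab)
  · exact ⟨(s.image f).equivFin ⟨f i, Finset.mem_image_of_mem f hi⟩, by simp [ht]⟩

theorem apply_perm_pow_of_eigenvector {α : Type*} {g : Equiv.Perm α} {ζ : ℂ} {v : α → ℂ}
    (hv : ∀ i, v (g i) = ζ * v i) (j : ℕ) (i : α) : v ((g ^ j) i) = ζ ^ j * v i := by
  induction j with
  | zero => simp
  | succ j ih => rw [pow_succ', Equiv.Perm.mul_apply, hv, ih, pow_succ']; ring

theorem IsPrimitiveRoot.exists_eq_pow_mul {ζ x y : ℂ} {r : ℕ} [NeZero r]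
    (hζ : IsPrimitiveRoot ζ r) (hy : y ≠ 0) (h : x ^ r = y ^ r) :
    ∃ j < r, x = ζ ^ j * y := by
  have h1 : (x / y) ^ r = 1 := by rw [div_pow, h, div_self (pow_ne_zero _ hy)]
  obtain ⟨j, hj, hjx⟩ := hζ.eq_pow_of_pow_eq_one h1
  exact ⟨j, hj, by rw [hjx, div_mul_cancel₀ _ hy]⟩

/-- An injective eigenvector provides representatives of the nontrivial cycles, all of which
have length `r`, and there is at most one fixed point. -/
theorem exists_cycle_representatives {m r : ℕ} (hr : 2 ≤ r) {ζ : ℂ}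
    (hζ : IsPrimitiveRoot ζ r) {g : Equiv.Perm (Fin m)} {v : Fin m → ℂ}
    (hinj : Function.Injective v) (hv : ∀ i, v (g i) = ζ * v i) :
    ∃ t : Fin (if r ∣ m then m / r else (m - 1) / r) → Fin m,
      (∀ a, v (t a) ≠ 0) ∧ (∀ a b, v (t a) ^ r = v (t b) ^ r → a = b) ∧
      ∀ i, v i ≠ 0 → ∃ a, ∃ j < r, i = (g ^ j) (t a) := by
  classical
  have : NeZero r := ⟨by omega⟩
  have hζ0 : ζ ≠ 0 := hζ.ne_zero (by omega)
  obtain ⟨k, t, hts, hti, htr⟩ := exists_fin_fibre_representatives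
    (Finset.univ.filter fun i => v i ≠ 0) (fun i => v i ^ r)
  simp only [Finset.mem_filter, Finset.mem_univ, true_and] at hts htr
  have hcov : ∀ i, v i ≠ 0 → ∃ a, ∃ j < r, i = (g ^ j) (t a) := by
    intro i hi
    obtain ⟨a, ha⟩ := htr i hi
    obtain ⟨j, hj, hij⟩ := hζ.exists_eq_pow_mul (hts a) ha
    exact ⟨a, j, hj, hinj (by rw [apply_perm_pow_of_eigenvector hv, hij])⟩
  have hcard : (Finset.univ.filter fun i => v i ≠ 0).card = k * r := by
    have himg : (Finset.univ.filter fun i => v i ≠ 0) =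
        (Finset.univ : Finset (Fin k × Fin r)).image fun p => (g ^ (p.2 : ℕ)) (t p.1) := by
      ext i
      simp only [Finset.mem_filter, Finset.mem_univ, true_and, Finset.mem_image, Prod.exists]
      constructor
      · intro hi
        obtain ⟨a, j, hj, rfl⟩ := hcov i hi
        exact ⟨a, ⟨j, hj⟩, rfl⟩
      · rintro ⟨a, j, rfl⟩
        rw [apply_perm_pow_of_eigenvector hv]
        exact mul_ne_zero (pow_ne_zero _ hζ0) (hts a)
    rw [himg, Finset.card_image_of_injective, Finset.card_univ, Fintype.card_prod,
      Fintype.card_fin, Fintype.card_fin]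
    rintro ⟨a, i⟩ ⟨b, j⟩ hab
    have h := congrArg v hab
    simp only [apply_perm_pow_of_eigenvector hv] at h
    have hab' : a = b := by
      apply hti
      have h2 := congrArg (· ^ r) h
      simpa [mul_pow, ← pow_mul, mul_comm _ r, pow_mul ζ r, hζ.pow_eq_one] using h2
    subst hab'
    have := hζ.pow_inj i.2 j.2 (mul_right_cancel₀ (hts a) h)
    simp [Fin.ext_iff, this]
  have hzero : (Finset.univ.filter fun i => ¬ v i ≠ 0).card ≤ 1 := by
    rw [Finset.card_le_one]
    intro a ha b hb
    simp only [Finset.mem_filter, Finset.mem_univ, true_and, not_not] at ha hb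
    exact hinj (ha.trans hb.symm)
  have hsum := Finset.card_filter_add_card_filter_not (s := (Finset.univ : Finset (Fin m)))
    (fun i => v i ≠ 0)
  rw [hcard, Finset.card_univ, Fintype.card_fin] at hsum
  have hk : k = if r ∣ m then m / r else (m - 1) / r := by
    have hcases : m = k * r ∨ m = k * r + 1 := by omega
    rcases hcases with h | h
    · rw [if_pos ⟨k, by rw [h, mul_comm]⟩, h, Nat.mul_div_cancel _ (by omega)]
    · have hnd : ¬ r ∣ m := by
        intro hd
        rw [h] at hd
        have := (Nat.dvd_add_right (Dvd.intro_left k rfl)).mp hd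
        have := Nat.le_of_dvd one_pos this
        omega
      rw [if_neg hnd, h, Nat.add_sub_cancel, Nat.mul_div_cancel _ (by omega)]
  rw [← hk]
  exact ⟨t, hts, fun a b h => hti h, hcov⟩

/-- Let `m ≥ 1`, `r ≥ 2`, `ζ` a primitive `r`-th root of unity, and `g` a
permutation of `{1,…,m}` admitting an injective eigenvector of eigenvalue `ζ`. With
`k := m/r` if `r ∣ m` and `k := (m−1)/r` otherwise, the space of injective eigenvectors of
`g` of eigenvalue `ζ` is homeomorphic to `M^#(r,k)`. -/
theorem stmt9 (m r : ℕ) (hm : 1 ≤ m) (hr : 2 ≤ r)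
    (ζ : ℂ) (hζ : IsPrimitiveRoot ζ r)
    (g : Equiv.Perm (Fin m))
    (hex : ∃ v : Fin m → ℂ, Function.Injective v ∧ ∀ i, v (g i) = ζ * v i) :
    Nonempty
      ({v : Fin m → ℂ // Function.Injective v ∧ ∀ i, v (g i) = ζ * v i} ≃ₜ
        ↥(MregSharp r (if r ∣ m then m / r else (m - 1) / r))) := by
  obtain ⟨u, hu, hgu⟩ := hex
  obtain ⟨t, ht0, htr, hcov⟩ := exists_cycle_representatives hr hζ hu hgu
  generalize (if r ∣ m then m / r else (m - 1) / r) = k at t ht0 htr hcov ⊢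
  have : NeZero r := ⟨by omega⟩
  have hζ0 : ζ ≠ 0 := hζ.ne_zero (by omega)
  have hζ1 : ζ ≠ 1 := hζ.ne_one (by omega)
  have hfix : ∀ v : Fin m → ℂ, Function.Injective v → (∀ i, v (g i) = ζ * v i) →
      ∀ i, v i = 0 ↔ g i = i := by
    intro v hv hgv i
    constructor
    · intro h
      exact hv (by rw [hgv, h, mul_zero])
    · intro h
      have h1 := hgv i
      rw [h] at h1
      have h2 : (ζ - 1) * v i = 0 := by linear_combination -h1
      exact (mul_eq_zero.mp h2).resolve_left (sub_ne_zero.mpr hζ1)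
  have hpow : ∀ (j : ℕ) (x : ℂ), (ζ ^ j * x) ^ r = x ^ r := by
    intro j x
    rw [mul_pow, ← pow_mul, mul_comm j r, pow_mul, hζ.pow_eq_one, one_pow, one_mul]
  have huniq : ∀ a b i j, (g ^ i) (t a) = (g ^ j) (t b) → a = b ∧ ζ ^ i = ζ ^ j := by
    intro a b i j h
    have h1 := congrArg u h
    simp only [apply_perm_pow_of_eigenvector hgu] at h1
    have hab : a = b := htr a b (by rw [← hpow i, h1, hpow])
    subst hab
    exact ⟨rfl, mul_right_cancel₀ (ht0 a) h1⟩
  choose A J _ hAJ using hcov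
  let w : (Fin k → ℂ) → Fin m → ℂ := fun l i =>
    if h : u i = 0 then 0 else ζ ^ J i h * l (A i h)
  have hw0 : ∀ l i, u i = 0 → w l i = 0 := fun l i h => dif_pos h
  have hw : ∀ l j a, w l ((g ^ j) (t a)) = ζ ^ j * l a := by
    intro l j a
    have h : u ((g ^ j) (t a)) ≠ 0 := by
      rw [apply_perm_pow_of_eigenvector hgu]
      exact mul_ne_zero (pow_ne_zero _ hζ0) (ht0 a)
    obtain ⟨h1, h2⟩ := huniq _ _ _ _ (hAJ _ h)
    simp only [w, dif_neg h]
    rw [← h1, ← h2]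
  have hwg : ∀ l i, w l (g i) = ζ * w l i := by
    intro l i
    by_cases h : u i = 0
    · rw [(hfix u hu hgu i).mp h, hw0 l i h, mul_zero]
    · rw [hAJ i h, ← Equiv.Perm.mul_apply, ← pow_succ', hw, hw, pow_succ', mul_assoc]
  have hwinj : ∀ l ∈ MregSharp r k, Function.Injective (w l) := by
    rintro l ⟨hl, hl0⟩
    have hne : ∀ i, u i ≠ 0 → w l i ≠ 0 := by
      intro i h
      rw [hAJ i h, hw]
      exact mul_ne_zero (pow_ne_zero _ hζ0) (hl0 _)
    intro i j hij
    by_cases hi : u i = 0 <;> by_cases hj : u j = 0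
    · exact hu (hi.trans hj.symm)
    · exact absurd (hij.symm.trans (hw0 l i hi)) (hne j hj)
    · exact absurd (hij.trans (hw0 l j hj)) (hne i hi)
    · rw [hAJ i hi, hAJ j hj, hw, hw] at hij
      have hA : A i hi = A j hj := by
        by_contra hA
        exact hl _ _ hA (by rw [← hpow (J i hi), hij, hpow])
      rw [hA] at hij
      have hJ := mul_right_cancel₀ (hl0 _) hij
      apply hu
      rw [hAJ i hi, hAJ j hj, apply_perm_pow_of_eigenvector hgu,
        apply_perm_pow_of_eigenvector hgu, hJ, hA]
  have hmem : ∀ v : Fin m → ℂ, Function.Injective v → (∀ i, v (g i) = ζ * v i) →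
      v ∘ t ∈ MregSharp r k := by
    intro v hv hgv
    have hne : ∀ a, v (t a) ≠ 0 := fun a h =>
      ht0 a ((hfix u hu hgu _).mpr ((hfix v hv hgv _).mp h))
    refine ⟨fun a b hab h => hab ?_, hne⟩
    obtain ⟨j, -, hj⟩ := hζ.exists_eq_pow_mul (hne b) h
    refine (huniq a b 0 j ?_).1
    apply hv
    rw [apply_perm_pow_of_eigenvector hgv, apply_perm_pow_of_eigenvector hgv, pow_zero, one_mul]
    exact hj
  exact ⟨{
    toFun := fun v => ⟨v.1 ∘ t, hmem v.1 v.2.1 v.2.2⟩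
    invFun := fun l => ⟨w l.1, hwinj l.1 l.2, hwg l.1⟩
    left_inv := by
      rintro ⟨v, hv, hgv⟩
      apply Subtype.ext
      funext i
      change w (v ∘ t) i = v i
      by_cases h : u i = 0
      · rw [hw0 _ i h, (hfix v hv hgv i).mpr ((hfix u hu hgu i).mp h)]
      · rw [hAJ i h, hw, apply_perm_pow_of_eigenvector hgv, Function.comp_apply]
    right_inv := by
      rintro ⟨l, hl⟩
      apply Subtype.ext
      funext a
      change w l (t a) = l a
      simpa using hw l 0 a
    continuous_toFun := by
      refine Continuous.subtype_mk (continuous_pi fun a => ?_) _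
      exact (continuous_apply (t a)).comp continuous_subtype_val
    continuous_invFun := by
      refine Continuous.subtype_mk (continuous_pi fun i => ?_) _
      by_cases h : u i = 0
      · simp only [w, dif_pos h]
        exact continuous_const
      · simp only [w, dif_neg h]
        exact continuous_const.mul ((continuous_apply _).comp continuous_subtype_val) }⟩
end

section
/- Let m ≥ 2 and r ≥ 2 be integers and ζ ∈ ℂ a primitive r-th root of unity. Let w ∈ W_BC(m) and suppose there exists a BC-regular vector v ∈ ℂ^m with w·v = ζ·v. Set B := {v' ∈ ℂ^m : v' is BC-regular and w·v' = ζ·v'}, with the subspace topology from ℂ^m. Then exactly one of the following two cases occurs: (1) r is odd, r divides m, and B is homeomorphic to M^#(2r, m/r); (2) r is even, r divides 2m, and B is homeomorphic to M^#(r, 2m/r). -/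
/-- The space of BC-regular `ζ`-eigenvectors of the signed permutation `(σ, ε)` acting on
`ℂ^m` by `(w·v)(i) = ε(i)·v(σ⁻¹(i))`, with the subspace topology. -/
abbrev BCRegEig (m : ℕ) (ζ : ℂ) (σ : Equiv.Perm (Fin m)) (ε : Fin m → ℂ) :=
  {v : Fin m → ℂ // ((∀ i, v i ≠ 0) ∧ ∀ i j, i ≠ j → v i ^ 2 ≠ v j ^ 2) ∧
    ∀ i, ε i * v (σ.symm i) = ζ * v i}

section SignedPermutation

variable {ι : Type*} {ζ : ℂ} {τ : Equiv.Perm ι} {ε v : ι → ℂ}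

theorem sq_apply_pow_of_eigenvector (hε : ∀ i, ε i = 1 ∨ ε i = -1)
    (h : ∀ i, ε i * v (τ i) = ζ * v i) (n : ℕ) (i : ι) :
    v ((τ ^ n) i) ^ 2 = (ζ ^ 2) ^ n * v i ^ 2 := by
  induction n with
  | zero => simp
  | succ n ih =>
    have h1 : v (τ ((τ ^ n) i)) ^ 2 = ζ ^ 2 * v ((τ ^ n) i) ^ 2 := by
      rw [← mul_pow, ← h, mul_pow]
      rcases hε ((τ ^ n) i) with h2 | h2 <;> simp [h2]
    rw [pow_succ' τ, Equiv.Perm.mul_apply, h1, ih, pow_succ' (ζ ^ 2), mul_assoc]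

theorem eq_of_sq_eq_of_regular (hreg : ∀ i j, i ≠ j → v i ^ 2 ≠ v j ^ 2) {i j : ι}
    (h : v i ^ 2 = v j ^ 2) : i = j :=
  not_imp_comm.1 (hreg i j) (not_not.2 h)

theorem pow_eq_one_of_regular_eigenvector {s : ℕ} (hs : IsPrimitiveRoot (ζ ^ 2) s)
    (hε : ∀ i, ε i = 1 ∨ ε i = -1) (h : ∀ i, ε i * v (τ i) = ζ * v i)
    (hreg : ∀ i j, i ≠ j → v i ^ 2 ≠ v j ^ 2) : τ ^ s = 1 := by
  ext1 i
  apply eq_of_sq_eq_of_regular hreg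
  rw [sq_apply_pow_of_eigenvector hε h, hs.pow_eq_one, one_mul, Equiv.Perm.one_apply]

/-- The set of cycles of a permutation, fixed points included. -/
abbrev CycleOrbits (τ : Equiv.Perm ι) := Quotient (Equiv.Perm.SameCycle.setoid τ)

theorem exists_pow_apply_out [Finite ι] (τ : Equiv.Perm ι) (i : ι) :
    ∃ n : ℕ, (τ ^ n) (Quotient.mk _ i : CycleOrbits τ).out = i := by
  have h : τ.SameCycle (Quotient.mk _ i : CycleOrbits τ).out i :=
    Quotient.mk_out (s := Equiv.Perm.SameCycle.setoid τ) i
  exact h.exists_nat_pow_eq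

theorem mk_pow_apply_out (τ : Equiv.Perm ι) (n : ℕ) (q : CycleOrbits τ) :
    (Quotient.mk _ ((τ ^ n) q.out) : CycleOrbits τ) = q := by
  conv_rhs => rw [← q.out_eq]
  refine Quotient.sound ?_
  exact Equiv.Perm.SameCycle.symm ⟨n, by simp⟩

/-- If a permutation has a regular eigenvector, all its cycles have the same length. -/
theorem card_eq_card_cycleOrbits_mul [Finite ι] {s : ℕ} (hs0 : 0 < s)
    (hs : IsPrimitiveRoot (ζ ^ 2) s)
    (hε : ∀ i, ε i = 1 ∨ ε i = -1) (h : ∀ i, ε i * v (τ i) = ζ * v i)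
    (hreg : ∀ i j, i ≠ j → v i ^ 2 ≠ v j ^ 2) (hv : ∀ i, v i ≠ 0) :
    Nat.card ι = Nat.card (CycleOrbits τ) * s := by
  have hbij : Function.Bijective
      (fun p : CycleOrbits τ × Fin s => (τ ^ (p.2 : ℕ)) p.1.out) := by
    constructor
    · rintro ⟨q, a⟩ ⟨q', b⟩ hab
      dsimp only at hab
      obtain rfl : q = q' := by rw [← mk_pow_apply_out τ a q, hab, mk_pow_apply_out]
      have h1 := congrArg (fun i => v i ^ 2) hab
      simp only [sq_apply_pow_of_eigenvector hε h] at h1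
      have h2 := hs.pow_inj a.2 b.2 (mul_right_cancel₀ (pow_ne_zero 2 (hv _)) h1)
      rw [Fin.ext h2]
    · intro i
      obtain ⟨n, hn⟩ := exists_pow_apply_out τ i
      refine ⟨⟨Quotient.mk _ i, ⟨n % s, Nat.mod_lt _ hs0⟩⟩, ?_⟩
      dsimp only
      rw [← pow_eq_pow_mod n (pow_eq_one_of_regular_eigenvector hs hε h hreg), hn]
  rw [← Nat.card_congr (Equiv.ofBijective _ hbij), Nat.card_prod, Nat.card_fin]

end SignedPermutation

/-- A nonvanishing eigenvector identifies the other eigenvectors with functions on cycles. -/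
theorem div_eq_div_out_of_eigenvectors {ι : Type*} [Finite ι] {ζ : ℂ} {τ : Equiv.Perm ι}
    {ε u v : ι → ℂ} (hζ : ζ ≠ 0) (hε : ∀ i, ε i = 1 ∨ ε i = -1)
    (hu : ∀ i, ε i * u (τ i) = ζ * u i) (hv : ∀ i, ε i * v (τ i) = ζ * v i) (i : ι) :
    u i / v i = u (Quotient.mk _ i : CycleOrbits τ).out /
      v (Quotient.mk _ i : CycleOrbits τ).out := by
  have hstep : ∀ j, u (τ j) / v (τ j) = u j / v j := by
    intro j
    have hεj : ε j ≠ 0 := by rcases hε j with h | h <;> simp [h]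
    rw [← mul_div_mul_left _ _ hεj, hu, hv, mul_div_mul_left _ _ hζ]
  have hpow : ∀ (n : ℕ) j, u ((τ ^ n) j) / v ((τ ^ n) j) = u j / v j := by
    intro n j
    induction n with
    | zero => simp
    | succ n ih => rw [pow_succ', Equiv.Perm.mul_apply, hstep, ih]
  obtain ⟨n, hn⟩ := exists_pow_apply_out τ i
  conv_lhs => rw [← hn]
  exact hpow n _

theorem continuous_apply_val {ι : Type*} (P : (ι → ℂ) → Prop) (i : ι) :
    Continuous fun v : Subtype P => v.1 i :=
  (continuous_apply i).comp continuous_subtype_val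

theorem dvd_and_nonempty_homeomorph_mregSharp {m s : ℕ} (hs0 : 0 < s) {ζ : ℂ}
    (hs : IsPrimitiveRoot (ζ ^ 2) s) {σ : Equiv.Perm (Fin m)} {ε : Fin m → ℂ}
    (hε : ∀ i, ε i = 1 ∨ ε i = -1) (w : BCRegEig m ζ σ ε) :
    s ∣ m ∧ Nonempty (BCRegEig m ζ σ ε ≃ₜ ↥(MregSharp (2 * s) (m / s))) := by
  obtain ⟨w, ⟨hw0, hwreg⟩, hw⟩ := w
  have hζ : ζ ≠ 0 := by
    rintro rfl
    exact hs.ne_zero hs0.ne' (by simp)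
  set τ : Equiv.Perm (Fin m) := σ.symm
  have hcard := card_eq_card_cycleOrbits_mul hs0 hs hε hw hwreg hw0
  rw [Nat.card_fin] at hcard
  have hk : Nat.card (CycleOrbits τ) = m / s :=
    Nat.eq_div_of_mul_eq_left hs0.ne' hcard.symm
  refine ⟨⟨_, hcard.trans (mul_comm _ _)⟩, ?_⟩
  let e : CycleOrbits τ ≃ Fin (m / s) := Finite.equivFinOfCardEq hk
  let p : Fin m → CycleOrbits τ := fun i => Quotient.mk _ i
  have hp : ∀ q : CycleOrbits τ, p q.out = q := fun q => q.out_eq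
  have hpτ : ∀ i, p (τ i) = p i := fun i =>
    Quotient.sound (Equiv.Perm.sameCycle_apply_left.2 (Equiv.Perm.SameCycle.refl _ _))
  let c : Fin m → ℂ := fun i => w i / w (p i).out
  have hc0 : ∀ i, c i ≠ 0 := fun i => div_ne_zero (hw0 _) (hw0 _)
  have hc : ∀ i, ε i * c (τ i) = ζ * c i := by
    intro i
    simp only [c, hpτ, ← mul_div_assoc, hw]
  have hcout : ∀ q : CycleOrbits τ, c q.out = 1 := by
    intro q
    simp only [c, hp]
    exact div_self (hw0 _)
  have hcpow : ∀ i, (c i ^ 2) ^ s = 1 := by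
    intro i
    obtain ⟨n, hn⟩ := exists_pow_apply_out τ i
    rw [← hn, sq_apply_pow_of_eigenvector hε hc, hcout, one_pow, mul_one, ← pow_mul,
      mul_comm, pow_mul, hs.pow_eq_one, one_pow]
  refine ⟨⟨⟨fun v => ⟨fun a => v.1 (e.symm a).out, ?_, fun a => v.2.1.1 _⟩,
    fun l => ⟨fun i => c i * l.1 (e (p i)), ⟨fun i => mul_ne_zero (hc0 i) (l.2.2 _), ?_⟩, ?_⟩,
    ?_, ?_⟩, ?_, ?_⟩⟩
  · obtain ⟨v, ⟨hv0, hvreg⟩, hv⟩ := v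
    intro a b hab heq
    rw [pow_mul, pow_mul] at heq
    have : NeZero s := ⟨hs0.ne'⟩
    have hb := pow_ne_zero 2 (hv0 (e.symm b).out)
    obtain ⟨n, -, hn⟩ := hs.eq_pow_of_pow_eq_one
      (ξ := v (e.symm a).out ^ 2 / v (e.symm b).out ^ 2)
      (by rw [div_pow, heq, div_self (pow_ne_zero _ hb)])
    rw [eq_div_iff hb, ← sq_apply_pow_of_eigenvector hε hv] at hn
    have h1 := congrArg p (eq_of_sq_eq_of_regular hvreg hn)
    rw [hp, show p _ = _ from mk_pow_apply_out τ n _] at h1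
    exact hab (e.symm.injective h1).symm
  · obtain ⟨l, hl, hl0⟩ := l
    intro i j hij heq
    dsimp only at heq
    rw [mul_pow, mul_pow] at heq
    by_cases hpij : p i = p j
    · rw [hpij] at heq
      have h1 := mul_right_cancel₀ (pow_ne_zero 2 (hl0 _)) heq
      simp only [c, hpij, div_pow] at h1
      exact hwreg i j hij ((div_left_inj' (pow_ne_zero 2 (hw0 _))).1 h1)
    · have h1 := congrArg (· ^ s) heq
      rw [mul_pow, mul_pow, hcpow, hcpow, one_mul, one_mul, ← pow_mul, ← pow_mul] at h1
      exact hl _ _ (e.injective.ne hpij) h1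
  · intro i
    change ε i * (c (τ i) * l.1 (e (p (τ i)))) = ζ * (c i * l.1 (e (p i)))
    rw [hpτ, ← mul_assoc, hc, mul_assoc]
  · rintro ⟨v, ⟨hv0, hvreg⟩, hv⟩
    ext i
    have h1 := div_eq_div_out_of_eigenvectors hζ hε hv hw i
    simp only [c, p, Equiv.symm_apply_apply]
    rw [div_mul_eq_mul_div, mul_div_assoc, ← h1, mul_div_cancel₀ _ (hw0 i)]
  · rintro ⟨l, hl⟩
    ext a
    simp [hcout, hp]
  · exact Continuous.subtype_mk
      (continuous_pi fun _ => continuous_apply_val _ _) _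
  · exact Continuous.subtype_mk (continuous_pi fun _ => continuous_const.mul
      (continuous_apply_val _ _)) _

/-- Let `m ≥ 2`, `r ≥ 2`, `ζ` a primitive `r`-th root of unity, and
`w = (σ,ε) ∈ W_BC(m)` admitting a BC-regular `ζ`-eigenvector. Then exactly one of:
(1) `r` is odd, `r ∣ m`, and the space of BC-regular `ζ`-eigenvectors of `w` is
homeomorphic to `M^#(2r, m/r)`; (2) `r` is even, `r ∣ 2m`, and it is homeomorphic to
`M^#(r, 2m/r)`. -/
theorem stmt10 (m r : ℕ) (hm : 2 ≤ m) (hr : 2 ≤ r)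
    (ζ : ℂ) (hζ : IsPrimitiveRoot ζ r)
    (σ : Equiv.Perm (Fin m)) (ε : Fin m → ℂ) (hε : ∀ i, ε i = 1 ∨ ε i = -1)
    (hex : ∃ v : Fin m → ℂ, ((∀ i, v i ≠ 0) ∧ ∀ i j, i ≠ j → v i ^ 2 ≠ v j ^ 2) ∧
      ∀ i, ε i * v (σ.symm i) = ζ * v i) :
    Xor'
      (Odd r ∧ r ∣ m ∧
        Nonempty (BCRegEig m ζ σ ε ≃ₜ ↥(MregSharp (2 * r) (m / r))))
      (Even r ∧ r ∣ 2 * m ∧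
        Nonempty (BCRegEig m ζ σ ε ≃ₜ ↥(MregSharp r (2 * m / r)))) := by
  obtain ⟨v, hv⟩ := hex
  rcases Nat.even_or_odd r with he | ho
  · refine Or.inr ⟨?_, fun h => Nat.not_odd_iff_even.2 he h.1⟩
    obtain ⟨t, ht⟩ := id he
    obtain rfl : r = 2 * t := by omega
    obtain ⟨hd, hh⟩ := dvd_and_nonempty_homeomorph_mregSharp (by omega)
      (hζ.pow (by omega) rfl) hε ⟨v, hv⟩
    rw [Nat.mul_div_mul_left _ _ two_pos]
    refine ⟨he, Nat.mul_dvd_mul_left 2 hd, hh⟩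
  · refine Or.inl ⟨⟨ho, ?_⟩, fun h => Nat.not_odd_iff_even.2 h.1 ho⟩
    exact dvd_and_nonempty_homeomorph_mregSharp (by omega)
      (hζ.pow_of_coprime 2 (Nat.coprime_two_left.2 ho)) hε ⟨v, hv⟩
end

section
/- Let m ≥ 4 and r ≥ 2 be integers, ζ ∈ ℂ a primitive r-th root of unity, and w = (σ,ε) ∈ W_BC(m) with ∏_{i=1}^m ε(i) = −1. Suppose there exists a D-regular vector v ∈ ℂ^m with w·v = ζ·v. Then: if r is odd, then r divides m−1; and if r is even, then either r divides 2m with odd quotient 2m/r, or r divides 2m−2. -/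
/-- A function without zeros on a finite type that a permutation multiplies by factors `c i`
forces the product of these factors to be `1`. -/
theorem prod_eq_one_of_perm_eq_mul {ι : Type*} [Fintype ι] (σ : Equiv.Perm ι) (c u : ι → ℂ)
    (hu : ∀ i, u i ≠ 0) (h : ∀ i, u (σ i) = c i * u i) : ∏ i, c i = 1 := by
  have hprod : ∏ i, u i = (∏ i, c i) * ∏ i, u i := by
    rw [← Finset.prod_mul_distrib, ← Equiv.prod_comp σ u]
    exact Finset.prod_congr rfl fun i _ => h i
  exact (mul_eq_right₀ (Finset.prod_ne_zero_iff.2 fun i _ => hu i)).1 hprod.symm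

/-- Let `m ≥ 4`, `r ≥ 2`, `ζ` a primitive `r`-th root of unity, and
`w = (σ,ε) ∈ W_BC(m)` with `∏ ε i = −1`, admitting a D-regular `ζ`-eigenvector. Then:
if `r` is odd, `r ∣ m−1`; and if `r` is even, then either `r ∣ 2m` with `2m/r` odd, or
`r ∣ 2m−2`. -/
theorem stmt12 (m r : ℕ) (hm : 4 ≤ m) (hr : 2 ≤ r)
    (ζ : ℂ) (hζ : IsPrimitiveRoot ζ r)
    (σ : Equiv.Perm (Fin m)) (ε : Fin m → ℂ) (hε : ∀ i, ε i = 1 ∨ ε i = -1)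
    (hdet : ∏ i, ε i = -1)
    (v : Fin m → ℂ) (hreg : ∀ i j, i ≠ j → v i ^ 2 ≠ v j ^ 2)
    (heig : ∀ i, ε i * v (σ.symm i) = ζ * v i) :
    (Odd r → r ∣ (m - 1)) ∧
    (Even r → ((r ∣ 2 * m ∧ Odd (2 * m / r)) ∨ r ∣ (2 * m - 2))) := by
  have hε_sq : ∀ i, ε i * ε i = 1 := fun i => by rcases hε i with h | h <;> simp [h]
  have hv : ∀ i, v (σ.symm i) = ε i * ζ * v i := fun i => by
    rw [mul_assoc, ← heig i, ← mul_assoc, hε_sq, one_mul]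
  by_cases hz : ∃ k, v k = 0
  · obtain ⟨k, hk⟩ := hz
    have hne : ∀ i, i ≠ k → v i ≠ 0 := fun i hi h => hreg i k hi (by rw [h, hk])
    have hfix : σ.symm k = k := by
      by_contra h
      exact hne _ h (by rw [hv, hk, mul_zero])
    have hpow := prod_eq_one_of_perm_eq_mul σ.symm (fun i => if i = k then 1 else ζ ^ 2)
      (fun i => if i = k then 1 else v i ^ 2)
      (fun i => by
        by_cases h : i = k
        · simp [h]
        · simpa [h] using hne i h)
      (fun i => by
        by_cases h : i = k
        · simp [h, hfix]
        · have h' : σ.symm i ≠ k := fun e => h (σ.symm.injective (e.trans hfix.symm))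
          simp only [h, h', if_false, hv]
          linear_combination ζ ^ 2 * v i ^ 2 * hε_sq i)
    have hdvd : r ∣ 2 * (m - 1) := by
      apply hζ.dvd_of_pow_eq_one
      rw [pow_mul, ← hpow, Finset.prod_ite]
      simp [Finset.filter_ne', Finset.card_erase_of_mem]
    exact ⟨fun ho => (Nat.coprime_two_right.2 ho).dvd_of_dvd_mul_left hdvd,
      fun _ => Or.inr (by rwa [Nat.mul_sub] at hdvd)⟩
  · push Not at hz
    have hpow := prod_eq_one_of_perm_eq_mul σ.symm (fun i => ε i * ζ) v hz hv
    simp only [Finset.prod_mul_distrib, hdet, Finset.prod_const, Finset.card_univ,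
      Fintype.card_fin] at hpow
    have hζm : ζ ^ m = -1 := by linear_combination -hpow
    have hdvd : r ∣ 2 * m := hζ.dvd_of_pow_eq_one _ (by rw [mul_comm, pow_mul, hζm]; norm_num)
    have hndvd : ¬ r ∣ m := fun h => by
      rw [(hζ.pow_eq_one_iff_dvd m).2 h] at hζm
      norm_num at hζm
    refine ⟨fun ho => absurd ((Nat.coprime_two_right.2 ho).dvd_of_dvd_mul_left hdvd) hndvd,
      fun _ => Or.inl ⟨hdvd, ?_⟩⟩
    rw [← Nat.not_even_iff_odd]
    rintro ⟨q, hq⟩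
    refine hndvd ⟨q, ?_⟩
    have := Nat.mul_div_cancel' hdvd
    rw [hq, mul_add] at this
    omega
end

section
/- A nonzero exponential factor q is special if and only if its support E(q) is a special set of positive rationals. Equivalently: there exists j ∈ ℤ with exp(2πi·j·k) = −1 for every k in the support of q if and only if every k in the support has even denominator den(k) and, setting m := lcm over the support of den(k)/2, the integer 2m/den(k) is odd for every k in the support. -/
lemma exp_two_pi_mul_eq_neg_one_iff (j : ℤ) (k : ℚ) :
    Complex.exp (2 * Real.pi * Complex.I * (j : ℂ) * (k : ℂ)) = -1 ↔
      ∃ n : ℤ, 2 * j * k.num = (2 * n + 1) * k.den := by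
  rw [← Complex.exp_pi_mul_I, Complex.exp_eq_exp_iff_exists_int]
  refine exists_congr fun n => ?_
  have hd : (k.den : ℂ) ≠ 0 := by exact_mod_cast k.den_nz
  have hpi : (Real.pi : ℂ) * Complex.I ≠ 0 :=
    mul_ne_zero (by exact_mod_cast Real.pi_ne_zero) Complex.I_ne_zero
  have hk : (k : ℂ) * k.den = k.num := by exact_mod_cast Rat.mul_den_eq_num k
  have key : (2 * j * k.num = (2 * n + 1) * (k.den : ℤ)) ↔
      (2 * (j : ℂ) * k.num = (2 * n + 1) * k.den) := by norm_cast
  rw [key, ← hk]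
  constructor
  · intro h
    apply mul_left_cancel₀ hpi
    linear_combination (k.den : ℂ) * h
  · intro h
    apply mul_right_cancel₀ hd
    linear_combination (Real.pi * Complex.I : ℂ) * h

lemma exp_two_pi_mul_eq_neg_one_iff_even_den (j : ℤ) (k : ℚ) :
    Complex.exp (2 * Real.pi * Complex.I * (j : ℂ) * (k : ℂ)) = -1 ↔
      Even k.den ∧ ∃ c : ℤ, Odd c ∧ j = c * (k.den / 2 : ℕ) := by
  rw [exp_two_pi_mul_eq_neg_one_iff]
  have hcop : IsCoprime (k.den : ℤ) k.num := by
    rw [Int.isCoprime_iff_nat_coprime]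
    simpa using k.reduced.symm
  have hpos := k.den_pos
  constructor
  · rintro ⟨n, hn⟩
    have heven : Even k.den := by
      have h : Even ((2 * n + 1) * (k.den : ℤ)) := ⟨j * k.num, by linarith⟩
      rw [Int.even_mul] at h
      exact_mod_cast h.resolve_left (by simp)
    refine ⟨heven, ?_⟩
    obtain ⟨e, he⟩ := heven.two_dvd
    rw [he] at hn hcop hpos ⊢
    rw [Nat.mul_div_cancel_left _ two_pos]
    push_cast at hn hcop
    have hj : (e : ℤ) ∣ j := by
      refine hcop.of_mul_left_right.dvd_of_dvd_mul_right (z := k.num) ⟨2 * n + 1, ?_⟩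
      linarith
    obtain ⟨c, rfl⟩ := hj
    have he0 : (e : ℤ) ≠ 0 := by omega
    have hc : c * k.num = 2 * n + 1 := by
      apply mul_left_cancel₀ he0
      linarith
    exact ⟨c, (Int.odd_mul.1 ⟨n, hc⟩).1, mul_comm _ _⟩
  · rintro ⟨heven, c, hc, rfl⟩
    obtain ⟨e, he⟩ := heven.two_dvd
    rw [he] at hcop ⊢
    rw [Nat.mul_div_cancel_left _ two_pos]
    push_cast at hcop ⊢
    have hnum : Odd k.num := Int.isCoprime_two_left.1 hcop.of_mul_left_left
    obtain ⟨n, hn⟩ := hc.mul hnum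
    exact ⟨n, by linear_combination (2 * e : ℤ) * hn⟩


/-- A nonzero exponential factor `q` (a finitely supported `q : ℚ →₀ ℂ`
with positive support) is special — i.e. `σ^j q = −q` for some `j ∈ ℤ`, where
`(σ^j q)(k) = exp(2πi·j·k)·q(k)` — if and only if its support is a special set of positive
rationals: every `k` in the support has even denominator and, with
`m := lcm_{k ∈ supp q}(den(k)/2)`, the integer `2m/den(k)` is odd for every `k` in the
support. -/
theorem stmt13 (q : ℚ →₀ ℂ) (hq : q ≠ 0) (hsupp : ∀ k ∈ q.support, 0 < k) :
    (∃ j : ℤ, ∀ k : ℚ,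
        Complex.exp (2 * Real.pi * Complex.I * (j : ℂ) * (k : ℂ)) * q k = -(q k)) ↔
      ((∀ k ∈ q.support, Even k.den) ∧
        ∀ k ∈ q.support, Odd (2 * (q.support.lcm fun k' => k'.den / 2) / k.den)) := by
  have hspecial (j : ℤ) :
      (∀ k : ℚ, Complex.exp (2 * Real.pi * Complex.I * (j : ℂ) * (k : ℂ)) * q k = -(q k)) ↔
        ∀ k ∈ q.support, Even k.den ∧ ∃ c : ℤ, Odd c ∧ j = c * (k.den / 2 : ℕ) := by
    refine forall_congr' fun k => ?_
    rw [← exp_two_pi_mul_eq_neg_one_iff_even_den, Finsupp.mem_support_iff, ← neg_one_mul (q k),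
      mul_eq_mul_right_iff, or_iff_not_imp_right]
  have hdvd : ∀ k ∈ q.support, k.den / 2 ∣ q.support.lcm fun k' => k'.den / 2 :=
    fun k hk => Finset.dvd_lcm hk
  have hquot {k : ℚ} (hk : Even k.den) (m : ℕ) : 2 * m / k.den = m / (k.den / 2) := by
    conv_lhs => rw [← Nat.two_mul_div_two_of_even hk]
    exact Nat.mul_div_mul_left _ _ two_pos
  simp only [hspecial]
  constructor
  · rintro ⟨j, hj⟩
    refine ⟨fun k hk => (hj k hk).1, fun k hk => ?_⟩
    obtain ⟨heven, c, hc, hjc⟩ := hj k hk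
    rw [hquot heven]
    have hmj : ((q.support.lcm fun k' => k'.den / 2 : ℕ) : ℤ) ∣ j := by
      rw [Int.natCast_dvd]
      refine Finset.lcm_dvd fun k' hk' => ?_
      obtain ⟨-, c', -, hc'⟩ := hj k' hk'
      rw [← Int.natCast_dvd]
      exact ⟨c', by rw [hc', mul_comm]⟩
    obtain ⟨t, ht⟩ := hmj
    have hpos : 0 < k.den / 2 :=
      Nat.div_pos (Nat.le_of_dvd k.den_pos heven.two_dvd) two_pos
    obtain ⟨d, hd⟩ := hdvd k hk
    rw [hd] at ht ⊢
    rw [Nat.mul_div_cancel_left _ hpos]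
    have hcd : c = d * t := by
      apply mul_right_cancel₀ (b := ((k.den / 2 : ℕ) : ℤ)) (by exact_mod_cast hpos.ne')
      rw [← hjc, ht, Nat.cast_mul]
      ring
    rw [hcd] at hc
    exact_mod_cast (Int.odd_mul.1 hc).1
  · rintro ⟨heven, hodd⟩
    refine ⟨(q.support.lcm fun k' => k'.den / 2 : ℕ), fun k hk => ⟨heven k hk, _,
      (Int.odd_coe_nat _).2 (hodd k hk), ?_⟩⟩
    rw [hquot (heven k hk)]
    exact_mod_cast (Nat.div_mul_cancel (hdvd k hk)).symm
end

section
/- Let q be a nonzero exponential factor and r := ram(q). Then: (1) for j ∈ ℤ, σ^j q = q if and only if r divides j; in particular the Galois orbit {σ^j q : j ∈ ℤ} has exactly r elements; (2) the set {σ^j q : j ∈ ℤ} ∪ {−σ^j q : j ∈ ℤ} has exactly r elements if q is special and exactly 2r elements otherwise; in particular its cardinality belongs to {r, 2r}. -/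
/-- The `j`-th Galois conjugate `k ↦ exp (2πijk) · f k` of a function `f : ℚ → ℂ`. -/
noncomputable def galoisConj (j : ℤ) (f : ℚ → ℂ) : ℚ → ℂ := fun k =>
  Complex.exp (2 * Real.pi * Complex.I * (j : ℂ) * (k : ℂ)) * f k

lemma galoisConj_zero (f : ℚ → ℂ) : galoisConj 0 f = f := by
  ext k
  simp [galoisConj]

lemma galoisConj_galoisConj (i j : ℤ) (f : ℚ → ℂ) :
    galoisConj i (galoisConj j f) = galoisConj (i + j) f := by
  ext k
  simp only [galoisConj]
  rw [← mul_assoc, ← Complex.exp_add]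
  push_cast
  ring_nf

lemma galoisConj_neg (j : ℤ) (f : ℚ → ℂ) : galoisConj j (-f) = -galoisConj j f := by
  ext k
  simp [galoisConj]

lemma galoisConj_eq_iff (i j : ℤ) (f g : ℚ → ℂ) :
    galoisConj i f = galoisConj j g ↔ galoisConj (i - j) f = g := by
  constructor
  · intro h
    rw [sub_eq_neg_add, ← galoisConj_galoisConj, h, galoisConj_galoisConj, neg_add_cancel,
      galoisConj_zero]
  · rintro rfl
    rw [galoisConj_galoisConj, add_sub_cancel]

lemma exp_two_pi_mul_int_mul_rat_eq_one_iff (j : ℤ) (k : ℚ) :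
    Complex.exp (2 * Real.pi * Complex.I * (j : ℂ) * (k : ℂ)) = 1 ↔ (k.den : ℤ) ∣ j := by
  have hcop : IsCoprime (k.den : ℤ) k.num :=
    by
    rw [Int.isCoprime_iff_gcd_eq_one, Int.gcd_comm]
    exact k.reduced
  have key : (∃ n : ℤ, (j : ℚ) * k = n) ↔ (k.den : ℤ) ∣ j := by
    constructor
    · rintro ⟨n, hn⟩
      refine hcop.dvd_of_dvd_mul_right ⟨n, ?_⟩
      have h : (j : ℚ) * k.num = k.den * n := by
        rw [← hn, ← Rat.mul_den_eq_num k]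
        ring
      exact_mod_cast h
    · rintro ⟨m, rfl⟩
      refine ⟨m * k.num, ?_⟩
      push_cast
      rw [← Rat.mul_den_eq_num k]
      ring
  rw [Complex.exp_eq_one_iff, ← key]
  refine exists_congr fun n => ?_
  rw [show 2 * Real.pi * Complex.I * (j : ℂ) * (k : ℂ) =
    ((j : ℂ) * k) * (2 * Real.pi * Complex.I) by ring, mul_left_inj' Complex.two_pi_I_ne_zero]
  exact_mod_cast Iff.rfl

lemma galoisConj_eq_self_iff (q : ℚ →₀ ℂ) (j : ℤ) :
    galoisConj j q = q ↔ ((q.support.lcm fun k => k.den : ℕ) : ℤ) ∣ j := by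
  rw [Int.natCast_dvd, Finset.lcm_dvd_iff, funext_iff]
  refine forall_congr' fun k => ?_
  rw [← Int.natCast_dvd, ← exp_two_pi_mul_int_mul_rat_eq_one_iff, Finsupp.mem_support_iff]
  by_cases hk : q k = 0 <;> simp [galoisConj, hk]

lemma Set.ncard_range_of_eq_iff_dvd_sub {α : Type*} (f : ℤ → α) {r : ℕ} (hr : r ≠ 0)
    (hf : ∀ i j, f i = f j ↔ (r : ℤ) ∣ i - j) : (Set.range f).ncard = r := by
  have hr' : (0 : ℤ) < r := by positivity
  have himage : Set.range f = f '' Set.Ico 0 (r : ℤ) := by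
    refine (Set.image_subset_range _ _).antisymm' ?_
    rintro _ ⟨i, rfl⟩
    exact ⟨i % r, ⟨Int.emod_nonneg _ hr'.ne', Int.emod_lt_of_pos _ hr'⟩,
      (hf _ _).2 (Int.mod_modEq i r).symm.dvd⟩
  have hinj : Set.InjOn f (Set.Ico 0 (r : ℤ)) := by
    intro i hi j hj hij
    have := Int.emod_eq_emod_iff_emod_sub_eq_zero.2 (Int.emod_eq_zero_of_dvd ((hf i j).1 hij))
    rwa [Int.emod_eq_of_lt hi.1 hi.2, Int.emod_eq_of_lt hj.1 hj.2] at this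
  rw [himage, hinj.ncard_image, ← Finset.coe_Ico, Set.ncard_coe_finset]
  simp


/-- Let `q` be a nonzero exponential factor and `r := ram(q)` the lcm of
the denominators of its support. Then (1) `σ^j q = q` iff `r ∣ j`, and the Galois orbit
`{σ^j q : j ∈ ℤ}` has exactly `r` elements; (2) the set `{±σ^j q : j ∈ ℤ}` has exactly `r`
elements if `q` is special and `2r` elements otherwise; in particular its cardinality is
`r` or `2r`. -/
theorem stmt14 (q : ℚ →₀ ℂ) (hq : q ≠ 0) (hsupp : ∀ k ∈ q.support, 0 < k)
    (r : ℕ) (hr : r = q.support.lcm fun k => k.den) :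
    let orbit : Set (ℚ → ℂ) := {f | ∃ j : ℤ, ∀ k : ℚ,
      f k = Complex.exp (2 * Real.pi * Complex.I * (j : ℂ) * (k : ℂ)) * q k}
    let negOrbit : Set (ℚ → ℂ) := {f | ∃ j : ℤ, ∀ k : ℚ,
      f k = -(Complex.exp (2 * Real.pi * Complex.I * (j : ℂ) * (k : ℂ)) * q k)}
    (∀ j : ℤ,
        (∀ k : ℚ, Complex.exp (2 * Real.pi * Complex.I * (j : ℂ) * (k : ℂ)) * q k = q k) ↔
          (r : ℤ) ∣ j) ∧
    orbit.ncard = r ∧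
    ((∃ j : ℤ, ∀ k : ℚ,
        Complex.exp (2 * Real.pi * Complex.I * (j : ℂ) * (k : ℂ)) * q k = -(q k)) →
      (orbit ∪ negOrbit).ncard = r) ∧
    ((¬ ∃ j : ℤ, ∀ k : ℚ,
        Complex.exp (2 * Real.pi * Complex.I * (j : ℂ) * (k : ℂ)) * q k = -(q k)) →
      (orbit ∪ negOrbit).ncard = 2 * r) ∧
    ((orbit ∪ negOrbit).ncard = r ∨ (orbit ∪ negOrbit).ncard = 2 * r) := by
  intro orbit negOrbit
  have horbit : orbit = Set.range fun j => galoisConj j q := by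
    ext f
    simp only [orbit, Set.mem_ofPred_eq, Set.mem_range, funext_iff, galoisConj, eq_comm]
  have hnegOrbit : negOrbit = Set.range fun j => -galoisConj j q := by
    ext f
    simp only [negOrbit, Set.mem_ofPred_eq, Set.mem_range, funext_iff, galoisConj, Pi.neg_apply,
      eq_comm]
  have hr0 : r ≠ 0 := by
    rw [hr, Ne, Finset.lcm_eq_zero_iff]
    simp
  have hfix (j : ℤ) : galoisConj j q = q ↔ (r : ℤ) ∣ j := by
    rw [hr, galoisConj_eq_self_iff]
  have hspecial (j : ℤ) : (∀ k : ℚ, Complex.exp (2 * Real.pi * Complex.I * (j : ℂ) * (k : ℂ)) *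
      q k = -(q k)) ↔ galoisConj j q = -q := funext_iff.symm
  have hcard : orbit.ncard = r := by
    rw [horbit]
    exact Set.ncard_range_of_eq_iff_dvd_sub _ hr0 fun i j => by rw [galoisConj_eq_iff, hfix]
  have hnegcard : negOrbit.ncard = r := by
    rw [hnegOrbit]
    exact Set.ncard_range_of_eq_iff_dvd_sub _ hr0 fun i j => by
      rw [neg_inj, galoisConj_eq_iff, hfix]
  simp only [hspecial]
  have hcard_special (h : ∃ j : ℤ, galoisConj j q = -q) : (orbit ∪ negOrbit).ncard = r := by
    obtain ⟨j, hj⟩ := h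
    rw [Set.union_eq_self_of_subset_right, hcard]
    rw [horbit, hnegOrbit]
    rintro _ ⟨i, rfl⟩
    exact ⟨i + j, by simp only [← galoisConj_galoisConj, hj, galoisConj_neg]⟩
  have hcard_not_special (h : ¬ ∃ j : ℤ, galoisConj j q = -q) :
      (orbit ∪ negOrbit).ncard = 2 * r := by
    rw [Set.ncard_union_eq _ (Set.finite_of_ncard_ne_zero (by rwa [hcard]))
      (Set.finite_of_ncard_ne_zero (by rwa [hnegcard])), hcard, hnegcard, two_mul]
    rw [horbit, hnegOrbit, Set.disjoint_left]
    rintro _ ⟨i, rfl⟩ ⟨j, hj⟩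
    refine h ⟨i - j, ?_⟩
    rw [← galoisConj_eq_iff, galoisConj_neg]
    exact hj.symm
  refine ⟨fun j => funext_iff.symm.trans (hfix j), hcard, hcard_special, hcard_not_special, ?_⟩
  by_cases h : ∃ j : ℤ, galoisConj j q = -q
  · exact Or.inl (hcard_special h)
  · exact Or.inr (hcard_not_special h)
end

section
/- For every nonzero exponential factor q, the slope of q belongs to L_A(q) if and only if slope(q) is not an integer. -/
/-- The factor `exp (2πi·j·k)` is trivial when `k` is an integer. -/
theorem exp_two_pi_I_mul_int_mul_int (j n : ℤ) :
    Complex.exp (2 * Real.pi * Complex.I * (j : ℂ) * (n : ℂ)) = 1 :=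
  Complex.exp_eq_one_iff.2 ⟨j * n, by push_cast; ring⟩

/-- If `exp (2πi·k) = 1` for a rational number `k`, then `k` is an integer. -/
theorem exists_int_eq_of_exp_two_pi_I_mul_eq_one {k : ℚ}
    (h : Complex.exp (2 * Real.pi * Complex.I * (k : ℂ)) = 1) : ∃ n : ℤ, k = (n : ℚ) := by
  obtain ⟨n, hn⟩ := Complex.exp_eq_one_iff.1 h
  rw [mul_comm] at hn
  have hkn : (k : ℂ) = (n : ℂ) := mul_right_cancel₀ Complex.two_pi_I_ne_zero hn
  exact ⟨n, by exact_mod_cast hkn⟩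


/-- For a nonzero exponential factor `q`, the slope of `q` (the maximum of
its support) belongs to the type-A level set `L_A(q)` — i.e. there are `i, j ∈ ℤ` such that
`σ^i q − σ^j q` is nonzero of slope `slope(q)` — if and only if `slope(q)` is not an
integer. -/
theorem stmt15 (q : ℚ →₀ ℂ) (hq : q.support.Nonempty) (hpos : ∀ k ∈ q.support, 0 < k) :
    (∃ i j : ℤ,
        (Complex.exp (2 * Real.pi * Complex.I * (i : ℂ) * ((q.support.max' hq : ℚ) : ℂ)) -
            Complex.exp (2 * Real.pi * Complex.I * (j : ℂ) * ((q.support.max' hq : ℚ) : ℂ))) *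
            q (q.support.max' hq) ≠ 0 ∧
        ∀ k : ℚ,
          (Complex.exp (2 * Real.pi * Complex.I * (i : ℂ) * (k : ℂ)) -
              Complex.exp (2 * Real.pi * Complex.I * (j : ℂ) * (k : ℂ))) * q k ≠ 0 →
            k ≤ q.support.max' hq) ↔
      ¬ ∃ n : ℤ, (q.support.max' hq : ℚ) = (n : ℚ) := by
  constructor
  · rintro ⟨i, j, hne, -⟩ ⟨n, hn⟩
    apply hne
    rw [hn, Rat.cast_intCast, exp_two_pi_I_mul_int_mul_int, exp_two_pi_I_mul_int_mul_int,
      sub_self, zero_mul]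
  · intro hint
    refine ⟨1, 0, mul_ne_zero (fun h => hint ?_) ?_, fun k hk => ?_⟩
    · apply exists_int_eq_of_exp_two_pi_I_mul_eq_one
      simpa [sub_eq_zero] using h
    · exact Finsupp.mem_support_iff.1 (q.support.max'_mem hq)
    · exact q.support.le_max' k (Finsupp.mem_support_iff.2 (right_ne_zero_of_mul hk))
end

section
/- Assume that for every H-orbit O ⊆ S with O ∩ S' ≠ ∅, the set O ∩ S' is a single H'-orbit. Then the map ι̅ : S'/H' → S/H sending the H'-orbit of x ∈ S' to its H-orbit is well-defined and injective; moreover, if S' is closed in S then ι̅ is a closed topological embedding, and if S' is open in S then ι̅ is an open topological embedding. -/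
theorem equivalence_exists_smul_eq (H S : Type*) [Group H] [MulAction H S] :
    Equivalence fun x y : S => ∃ h : H, h • x = y where
  refl x := ⟨1, one_smul H x⟩
  symm := by
    rintro x _ ⟨h, rfl⟩
    exact ⟨h⁻¹, inv_smul_smul h x⟩
  trans := by
    rintro x _ _ ⟨h, rfl⟩ ⟨k, rfl⟩
    exact ⟨k * h, mul_smul k h x⟩

theorem preimage_image_quot_mk_smul {H S : Type*} [Group H] [MulAction H S] (U : Set S) :
    Quot.mk (fun x y : S => ∃ h : H, h • x = y) ⁻¹' (Quot.mk _ '' U) =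
      ⋃ h : H, (fun x : S => h • x) ⁻¹' U := by
  ext x
  simp only [Set.mem_preimage, Set.mem_image, Set.mem_iUnion]
  constructor
  · rintro ⟨y, hy, hyx⟩
    obtain ⟨h, rfl⟩ := ((equivalence_exists_smul_eq H S).quot_mk_eq_iff x y).1 hyx.symm
    exact ⟨h, hy⟩
  · rintro ⟨h, hx⟩
    exact ⟨h • x, hx, (Quot.sound ⟨h, rfl⟩).symm⟩

theorem isOpenMap_quot_mk_smul {H S : Type*} [Group H] [MulAction H S] [TopologicalSpace S]
    (hcont : ∀ h : H, Continuous fun x : S => h • x) :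
    IsOpenMap (Quot.mk fun x y : S => ∃ h : H, h • x = y) := by
  intro U hU
  rw [← isQuotientMap_quot_mk.isOpen_preimage, preimage_image_quot_mk_smul]
  exact isOpen_iUnion fun h => hU.preimage (hcont h)

theorem isClosedMap_quot_mk_smul {H S : Type*} [Group H] [Finite H] [MulAction H S]
    [TopologicalSpace S] (hcont : ∀ h : H, Continuous fun x : S => h • x) :
    IsClosedMap (Quot.mk fun x y : S => ∃ h : H, h • x = y) := by
  intro C hC
  rw [← isQuotientMap_quot_mk.isClosed_preimage, preimage_image_quot_mk_smul]
  exact isClosed_iUnion_of_finite fun h => hC.preimage (hcont h)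


/-- Let a finite group `H` act by homeomorphisms on a topological space
`S`, let `S' ⊆ S`, and let `H' := {h ∈ H : h • S' = S'}` be its setwise stabilizer. Assume
every nonempty intersection of an `H`-orbit with `S'` is a single `H'`-orbit (equivalently:
any two points of `S'` in the same `H`-orbit are `H'`-related). Then the induced map
`ι̅ : S'/H' → S/H` is well-defined and injective; moreover it is a closed topological
embedding if `S'` is closed in `S`, and an open topological embedding if `S'` is open. -/
theorem stmt18 {H S : Type*} [Group H] [Finite H] [MulAction H S] [TopologicalSpace S]
    (hcont : ∀ h : H, Continuous fun x : S => h • x)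
    (S' : Set S)
    (horb : ∀ y z : S, y ∈ S' → z ∈ S' → (∃ h : H, h • y = z) →
      ∃ h : H, (fun x : S => h • x) '' S' = S' ∧ h • y = z) :
    ∃ f : Quot (fun x y : S' => ∃ h : H,
          (fun z : S => h • z) '' S' = S' ∧ h • (x : S) = (y : S)) →
        Quot (fun x y : S => ∃ h : H, h • x = y),
      (∀ x : S', f (Quot.mk _ x) = Quot.mk _ (x : S)) ∧
      Function.Injective f ∧
      (IsClosed S' → Topology.IsClosedEmbedding f) ∧
      (IsOpen S' → Topology.IsOpenEmbedding f) := by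
  let f : Quot (fun x y : S' => ∃ h : H,
        (fun z : S => h • z) '' S' = S' ∧ h • (x : S) = (y : S)) →
      Quot (fun x y : S => ∃ h : H, h • x = y) :=
    Quot.map Subtype.val fun _ _ ⟨h, _, hxy⟩ => ⟨h, hxy⟩
  have hf : Continuous f :=
    continuous_quot_lift _ (continuous_quot_mk.comp continuous_subtype_val)
  have hinj : Function.Injective f := by
    rintro ⟨x⟩ ⟨y⟩ hxy
    exact Quot.sound (horb x y x.2 y.2
      (((equivalence_exists_smul_eq H S).quot_mk_eq_iff _ _).1 hxy))
  refine ⟨f, fun _ => rfl, hinj, fun hS => ?_, fun hS => ?_⟩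
  · refine .of_continuous_injective_isClosedMap hf hinj ?_
    exact .of_comp_surjective Quot.mk_surjective continuous_quot_mk
      ((isClosedMap_quot_mk_smul hcont).comp hS.isClosedMap_subtype_val)
  · refine .of_continuous_injective_isOpenMap hf hinj ?_
    intro U hU
    have himage := (isOpenMap_quot_mk_smul hcont).comp hS.isOpenMap_subtype_val _
      (hU.preimage continuous_quot_mk)
    rwa [show Quot.mk _ ∘ Subtype.val = f ∘ Quot.mk _ from rfl, Set.image_comp,
      Set.image_preimage_eq _ Quot.mk_surjective] at himage
end

section
/- Assume that for every H-orbit O ⊆ S with O ∩ S' ≠ ∅ the set O ∩ S' is a single H'-orbit, that S' is closed (or open) in S, and that moreover S' meets every H-orbit. Then the map ι̅ : S'/H' → S/H sending the H'-orbit of x ∈ S' to its H-orbit is a homeomorphism. -/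
/-- Two points have the same class in the orbit space iff they lie in the same orbit. -/
theorem quot_mk_eq_iff_exists_smul_eq {H S : Type*} [Group H] [MulAction H S] (x y : S) :
    Quot.mk (fun x y : S => ∃ h : H, h • x = y) x = Quot.mk _ y ↔ ∃ h : H, h • x = y :=
  (equivalence_exists_smul_eq H S).quot_mk_eq_iff x y

/-- If `f` is induced on quotients by the inclusion `S' ⊆ S`, the saturated subset of `S` over
`f '' T` is the union of the translates of the part of `S'` over `T`. -/
theorem preimage_quot_mk_image_eq_iUnion {H S : Type*} [Group H] [MulAction H S] {S' : Set S}
    {r : S' → S' → Prop} {f : Quot r → Quot fun x y : S => ∃ h : H, h • x = y}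
    (hf : ∀ x : S', f (Quot.mk _ x) = Quot.mk _ (x : S)) (T : Set (Quot r)) :
    Quot.mk _ ⁻¹' (f '' T) =
      ⋃ h : H, (fun x : S => h • x) ⁻¹' (Subtype.val '' (Quot.mk r ⁻¹' T)) := by
  ext x
  simp only [Set.mem_preimage, Set.mem_iUnion, Set.mem_image]
  constructor
  · rintro ⟨⟨y⟩, hy, hyx⟩
    obtain ⟨h, hh⟩ := (quot_mk_eq_iff_exists_smul_eq x (y : S)).1 (hyx.symm.trans (hf y))
    exact ⟨h, y, hy, hh.symm⟩
  · rintro ⟨h, y, hy, hyx⟩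
    exact ⟨Quot.mk r y, hy,
      (hf y).trans ((quot_mk_eq_iff_exists_smul_eq x (y : S)).2 ⟨h, hyx.symm⟩).symm⟩


/-- Let a finite group `H` act by homeomorphisms on a topological space
`S`, let `S' ⊆ S` with setwise stabilizer `H' := {h ∈ H : h • S' = S'}`. Assume every
nonempty intersection of an `H`-orbit with `S'` is a single `H'`-orbit, that `S'` is closed
(or open) in `S`, and that `S'` meets every `H`-orbit. Then the induced map
`ι̅ : S'/H' → S/H` is a homeomorphism. -/
theorem stmt19 {H S : Type*} [Group H] [Finite H] [MulAction H S] [TopologicalSpace S]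
    (hcont : ∀ h : H, Continuous fun x : S => h • x)
    (S' : Set S)
    (horb : ∀ y z : S, y ∈ S' → z ∈ S' → (∃ h : H, h • y = z) →
      ∃ h : H, (fun x : S => h • x) '' S' = S' ∧ h • y = z)
    (hclopen : IsClosed S' ∨ IsOpen S')
    (hmeets : ∀ x : S, ∃ y ∈ S', ∃ h : H, h • x = y) :
    ∃ e : Quot (fun x y : S' => ∃ h : H,
          (fun z : S => h • z) '' S' = S' ∧ h • (x : S) = (y : S)) ≃ₜ
        Quot (fun x y : S => ∃ h : H, h • x = y),
      ∀ x : S', e (Quot.mk _ x) = Quot.mk _ (x : S) := by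
  let f : Quot (fun x y : S' => ∃ h : H,
          (fun z : S => h • z) '' S' = S' ∧ h • (x : S) = (y : S)) →
        Quot (fun x y : S => ∃ h : H, h • x = y) :=
    Quot.map Subtype.val fun _ _ ⟨h, _, hxy⟩ => ⟨h, hxy⟩
  have hf : ∀ x : S', f (Quot.mk _ x) = Quot.mk _ (x : S) := fun _ => rfl
  have hfc : Continuous f :=
    continuous_quot_lift _ (continuous_quot_mk.comp continuous_subtype_val)
  have hinj : Function.Injective f := by
    rintro ⟨x⟩ ⟨y⟩ hxy
    exact Quot.sound (horb x y x.2 y.2 ((quot_mk_eq_iff_exists_smul_eq (x : S) (y : S)).1 hxy))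
  have hsurj : Function.Surjective f := by
    rintro ⟨x⟩
    obtain ⟨y, hy, hxy⟩ := hmeets x
    exact ⟨Quot.mk _ ⟨y, hy⟩, ((quot_mk_eq_iff_exists_smul_eq x y).2 hxy).symm⟩
  let e := Equiv.ofBijective f ⟨hinj, hsurj⟩
  rcases hclopen with hS' | hS'
  · refine ⟨e.toHomeomorphOfContinuousClosed hfc fun T hT => ?_, hf⟩
    refine isQuotientMap_quot_mk.isClosed_preimage.1 ?_
    refine (preimage_quot_mk_image_eq_iUnion hf T).symm ▸ isClosed_iUnion_of_finite fun h => ?_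
    exact (hS'.isClosedMap_subtype_val _ (hT.preimage continuous_quot_mk)).preimage (hcont h)
  · refine ⟨e.toHomeomorphOfContinuousOpen hfc fun T hT => ?_, hf⟩
    refine isQuotientMap_quot_mk.isOpen_preimage.1 ?_
    refine (preimage_quot_mk_image_eq_iUnion hf T).symm ▸ isOpen_iUnion fun h => ?_
    exact (hS'.isOpenMap_subtype_val _ (hT.preimage continuous_quot_mk)).preimage (hcont h)
end
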